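/- The function h̄_PB : ℝⁿ → ℝ is continuous on ℝⁿ, and for every x ∈ ℝⁿ the infimum defining h̄_PB(x) is attained by some input sequence u ∈ U^N. -/

import Mathlib

/-- Closed-loop trajectory: `traj f x u 0 = x`, `traj f x u (i+1) = f (traj f x u i, u i)`. -/
noncomputable def traj {n m : ℕ}
    (f : EuclideanSpace ℝ (Fin n) × EuclideanSpace ℝ (Fin m) → EuclideanSpace ℝ (Fin n))
    (x : EuclideanSpace ℝ (Fin n)) (u : ℕ → EuclideanSpace ℝ (Fin m)) :
    ℕ → EuclideanSpace ℝ (Fin n)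
  | 0 => x
  | i + 1 => f (traj f x u i, u i)

/-- Soft-constrained PCBF cost of an input sequence `u`:
`α_f · max 0 (h_f x_N) + Σ_{i<N} ‖max 0 (c x_i + Δ_i 𝟙)‖` (componentwise max,
Euclidean norm). -/
noncomputable def pcbfCost {n m nc : ℕ} (N : ℕ)
    (f : EuclideanSpace ℝ (Fin n) × EuclideanSpace ℝ (Fin m) → EuclideanSpace ℝ (Fin n))
    (c : EuclideanSpace ℝ (Fin n) → EuclideanSpace ℝ (Fin nc)) (Δ : ℕ → ℝ)
    (hf : EuclideanSpace ℝ (Fin n) → ℝ) (αf : ℝ)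
    (x : EuclideanSpace ℝ (Fin n)) (u : ℕ → EuclideanSpace ℝ (Fin m)) : ℝ :=
  αf * max 0 (hf (traj f x u N)) +
    ∑ i ∈ Finset.range N,
      ‖((fun j => max 0 (c (traj f x u i) j + Δ i)) : Fin nc → ℝ)‖

/-- The PCBF `h_PB x`: infimum of `pcbfCost` over admissible input sequences. -/
noncomputable def hPB {n m nc : ℕ} (N : ℕ) (U : Set (EuclideanSpace ℝ (Fin m)))
    (f : EuclideanSpace ℝ (Fin n) × EuclideanSpace ℝ (Fin m) → EuclideanSpace ℝ (Fin n))
    (c : EuclideanSpace ℝ (Fin n) → EuclideanSpace ℝ (Fin nc)) (Δ : ℕ → ℝ)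
    (hf : EuclideanSpace ℝ (Fin n) → ℝ) (αf : ℝ) (x : EuclideanSpace ℝ (Fin n)) : ℝ :=
  sInf ((fun u => pcbfCost N f c Δ hf αf x u) '' {u | ∀ i < N, u i ∈ U})

/-- Cost of the extended value function: `max { max_{i<N, j} ([c x_i]_j + Δ_i), h_f x_N }`. -/
noncomputable def extCost {n m nc : ℕ} (N : ℕ)
    (f : EuclideanSpace ℝ (Fin n) × EuclideanSpace ℝ (Fin m) → EuclideanSpace ℝ (Fin n))
    (c : EuclideanSpace ℝ (Fin n) → EuclideanSpace ℝ (Fin nc)) (Δ : ℕ → ℝ)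
    (hf : EuclideanSpace ℝ (Fin n) → ℝ)
    (x : EuclideanSpace ℝ (Fin n)) (u : ℕ → EuclideanSpace ℝ (Fin m)) : ℝ :=
  max (⨆ q : Fin N × Fin nc, (c (traj f x u q.1) q.2 + Δ q.1)) (hf (traj f x u N))

/-- The extended value function `h̄_PB x` (slacks not sign-constrained). -/
noncomputable def hbarPB {n m nc : ℕ} (N : ℕ) (U : Set (EuclideanSpace ℝ (Fin m)))
    (f : EuclideanSpace ℝ (Fin n) × EuclideanSpace ℝ (Fin m) → EuclideanSpace ℝ (Fin n))
    (c : EuclideanSpace ℝ (Fin n) → EuclideanSpace ℝ (Fin nc)) (Δ : ℕ → ℝ)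
    (hf : EuclideanSpace ℝ (Fin n) → ℝ) (x : EuclideanSpace ℝ (Fin n)) : ℝ :=
  sInf ((fun u => extCost N f c Δ hf x u) '' {u | ∀ i < N, u i ∈ U})

/-- The first `k` states only depend on the first `k` inputs. -/
theorem traj_congr {n m : ℕ}
    (f : EuclideanSpace ℝ (Fin n) × EuclideanSpace ℝ (Fin m) → EuclideanSpace ℝ (Fin n))
    (x : EuclideanSpace ℝ (Fin n)) {u v : ℕ → EuclideanSpace ℝ (Fin m)} {k : ℕ}
    (h : ∀ i < k, u i = v i) : traj f x u k = traj f x v k := by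
  induction k with
  | zero => rfl
  | succ k ih =>
    simp only [traj]
    rw [ih fun i hi => h i (hi.trans k.lt_succ_self), h k k.lt_succ_self]

theorem continuous_traj {n m : ℕ}
    {f : EuclideanSpace ℝ (Fin n) × EuclideanSpace ℝ (Fin m) → EuclideanSpace ℝ (Fin n)}
    (hfc : Continuous f) (k : ℕ) :
    Continuous fun p : EuclideanSpace ℝ (Fin n) × (ℕ → EuclideanSpace ℝ (Fin m)) =>
      traj f p.1 p.2 k := by
  induction k with
  | zero => exact continuous_fst
  | succ k ih =>
    exact hfc.comp (ih.prodMk ((continuous_apply k).comp continuous_snd))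

theorem extCost_congr {n m nc N : ℕ}
    (f : EuclideanSpace ℝ (Fin n) × EuclideanSpace ℝ (Fin m) → EuclideanSpace ℝ (Fin n))
    (c : EuclideanSpace ℝ (Fin n) → EuclideanSpace ℝ (Fin nc)) (Δ : ℕ → ℝ)
    (hf : EuclideanSpace ℝ (Fin n) → ℝ) (x : EuclideanSpace ℝ (Fin n))
    {u v : ℕ → EuclideanSpace ℝ (Fin m)} (h : ∀ i < N, u i = v i) :
    extCost N f c Δ hf x u = extCost N f c Δ hf x v := by
  have hq (q : Fin N × Fin nc) : traj f x u q.1 = traj f x v q.1 :=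
    traj_congr f x fun i hi => h i (hi.trans q.1.isLt)
  simp only [extCost, hq, traj_congr f x h]

theorem continuous_extCost {n m nc N : ℕ} (hN : 0 < N) (hnc : 0 < nc)
    {f : EuclideanSpace ℝ (Fin n) × EuclideanSpace ℝ (Fin m) → EuclideanSpace ℝ (Fin n)}
    (hfc : Continuous f)
    {c : EuclideanSpace ℝ (Fin n) → EuclideanSpace ℝ (Fin nc)} (hcc : Continuous c)
    (Δ : ℕ → ℝ) {hf : EuclideanSpace ℝ (Fin n) → ℝ} (hfcont : Continuous hf) :
    Continuous fun p : EuclideanSpace ℝ (Fin n) × (ℕ → EuclideanSpace ℝ (Fin m)) =>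
      extCost N f c Δ hf p.1 p.2 := by
  have : Nonempty (Fin N × Fin nc) := ⟨(⟨0, hN⟩, ⟨0, hnc⟩)⟩
  simp only [extCost, ← Finset.sup'_univ_eq_ciSup]
  refine Continuous.max ?_ (hfcont.comp (continuous_traj hfc N))
  refine Continuous.finset_sup'_apply _ fun q _ => ?_
  have hcq := hcc.comp (continuous_traj hfc (q.1 : ℕ))
  exact ((EuclideanSpace.proj (𝕜 := ℝ) q.2).continuous.comp hcq).add continuous_const

/-- Inputs after the horizon may be constrained to `U` without changing the attainable costs. -/
theorem extCost_image_eq {n m nc N : ℕ}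
    {U : Set (EuclideanSpace ℝ (Fin m))} (hUne : U.Nonempty)
    (f : EuclideanSpace ℝ (Fin n) × EuclideanSpace ℝ (Fin m) → EuclideanSpace ℝ (Fin n))
    (c : EuclideanSpace ℝ (Fin n) → EuclideanSpace ℝ (Fin nc)) (Δ : ℕ → ℝ)
    (hf : EuclideanSpace ℝ (Fin n) → ℝ) (x : EuclideanSpace ℝ (Fin n)) :
    extCost N f c Δ hf x '' {u | ∀ i < N, u i ∈ U} =
      extCost N f c Δ hf x '' Set.univ.pi fun _ => U := by
  obtain ⟨a, ha⟩ := hUne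
  apply Set.Subset.antisymm
  · rintro _ ⟨u, hu, rfl⟩
    refine ⟨fun i => if i < N then u i else a, fun i _ => ?_,
      extCost_congr f c Δ hf x fun i hi => if_pos hi⟩
    dsimp only
    split_ifs with hi
    · exact hu i hi
    · exact ha
  · exact Set.image_mono fun u hu i _ => hu i trivial

/-- The extended value function `h̄_PB` is continuous on `ℝⁿ` and its infimum is attained. -/
theorem stmt10
    {n m nc N : ℕ} (hN : 0 < N) (hnc : 0 < nc)
    (U : Set (EuclideanSpace ℝ (Fin m))) (hUcomp : IsCompact U) (hUne : U.Nonempty)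
    (f : EuclideanSpace ℝ (Fin n) × EuclideanSpace ℝ (Fin m) → EuclideanSpace ℝ (Fin n))
    (hfc : Continuous f)
    (c : EuclideanSpace ℝ (Fin n) → EuclideanSpace ℝ (Fin nc)) (hcc : Continuous c)
    (Δ : ℕ → ℝ)
    (hf : EuclideanSpace ℝ (Fin n) → ℝ) (hfcont : Continuous hf)
    (αf : ℝ) (hαf : 0 < αf) :
    Continuous (fun x => hbarPB N U f c Δ hf x) ∧
    ∀ x : EuclideanSpace ℝ (Fin n), ∃ u : ℕ → EuclideanSpace ℝ (Fin m),
      (∀ i < N, u i ∈ U) ∧ hbarPB N U f c Δ hf x = extCost N f c Δ hf x u := by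
  have hK : IsCompact (Set.univ.pi fun _ : ℕ => U) := isCompact_univ_pi fun _ => hUcomp
  have hcont := continuous_extCost (m := m) hN hnc hfc hcc Δ hfcont
  have hbar (x) : hbarPB N U f c Δ hf x =
      sInf (extCost N f c Δ hf x '' Set.univ.pi fun _ => U) :=
    congrArg sInf (extCost_image_eq hUne f c Δ hf x)
  simp only [hbar]
  refine ⟨hK.continuous_sInf hcont, fun x => ?_⟩
  obtain ⟨u, hu, hmin⟩ := hK.exists_sInf_image_eq (Set.univ_pi_nonempty_iff.2 fun _ => hUne)
    (hcont.comp (Continuous.prodMk_right x)).continuousOn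
  exact ⟨u, fun i _ => hu i trivial, hmin⟩
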